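/- Let p ≥ 2* = 2N/(N−1), and let v : ℝ^{N+1} → ℝ be a Schwartz function such that −Δv(x,y) + |x|² v(x,y) = 0 for all (x,y) with y > 0 and −∂v/∂y(x,0) = |v(x,0)|^{p−2} v(x,0) for all x ∈ ℝ^N. Then v vanishes identically on the closed half-space {(x,y) : y ≥ 0}. -/

import Mathlib

open MeasureTheory

noncomputable section

/-- `ℝ^N` as a Euclidean space. -/
abbrev RN (N : ℕ) := EuclideanSpace ℝ (Fin N)

/-- `ℝ^{N+1}`, with points written `(x, y)`, `x ∈ ℝ^N`, `y ∈ ℝ`. -/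
abbrev RN1 (N : ℕ) := RN N × ℝ

/-- The upper half-space `{(x,y) : y > 0}`. -/
def upperHalf (N : ℕ) : Set (RN1 N) := {p | 0 < p.2}

/-- The `i`-th horizontal coordinate direction in `ℝ^{N+1}`. -/
def dirX (N : ℕ) (i : Fin N) : RN1 N := (EuclideanSpace.single i 1, 0)

/-- The vertical coordinate direction in `ℝ^{N+1}`. -/
def dirY (N : ℕ) : RN1 N := (0, 1)

/-- `|∇v|²`, the squared norm of the full gradient of `v` at `p`. -/
def gradSq (N : ℕ) (v : RN1 N → ℝ) (p : RN1 N) : ℝ :=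
  (∑ i : Fin N, (fderiv ℝ v p (dirX N i)) ^ 2) + (fderiv ℝ v p (dirY N)) ^ 2

/-- The Laplacian of `v` at `p` (sum of pure second derivatives). -/
def lap (N : ℕ) (v : RN1 N → ℝ) (p : RN1 N) : ℝ :=
  (∑ i : Fin N, fderiv ℝ (fun q => fderiv ℝ v q (dirX N i)) p (dirX N i)) +
    fderiv ℝ (fun q => fderiv ℝ v q (dirY N)) p (dirY N)

/-- The critical exponent `2* = 2N/(N-1)`. -/
def twoStar (N : ℕ) : ℝ := 2 * N / (N - 1)

open SchwartzMap LineDeriv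

lemma schwartz_integral_fderiv_eq_zero {E : Type*} [NormedAddCommGroup E] [NormedSpace ℝ E]
    [MeasurableSpace E] [BorelSpace E] [FiniteDimensional ℝ E] (μ : Measure E) [μ.IsAddHaarMeasure]
    (f : 𝓢(E, ℝ)) (e : E) : ∫ x, fderiv ℝ f x e ∂μ = 0 := by
  have h := integral_bilinear_hasLineDerivAt_right_eq_neg_left_of_integrable (μ := μ) (v := e)
    (f := fun _ : E => (1 : ℝ)) (f' := fun _ => 0) (g := f) (g' := fun x => fderiv ℝ f x e)
    (B := ContinuousLinearMap.mul ℝ ℝ) (by simp)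
    (by simpa [← lineDerivOp_apply_eq_fderiv] using (∂_{e} f).integrable)
    (by simpa using f.integrable)
    (fun x _ => by simpa using (hasFDerivAt_const (𝕜 := ℝ) (1 : ℝ) x).hasLineDerivAt e)
    (fun x _ => (f.differentiableAt.hasFDerivAt).hasLineDerivAt e)
  simpa using h

/-- The product of a continuous linear functional and a Schwartz function, as a Schwartz function. -/
def linMul {E : Type*} [NormedAddCommGroup E] [NormedSpace ℝ E] (l : E →L[ℝ] ℝ)
    (f : 𝓢(E, ℝ)) : 𝓢(E, ℝ) := smulLeftCLM ℝ l f

lemma linMul_apply {E : Type*} [NormedAddCommGroup E] [NormedSpace ℝ E] (l : E →L[ℝ] ℝ)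
    (f : 𝓢(E, ℝ)) (x : E) : linMul l f x = l x * f x :=
  smulLeftCLM_apply_apply l.hasTemperateGrowth f x

lemma fderiv_linMul {E : Type*} [NormedAddCommGroup E] [NormedSpace ℝ E] (l : E →L[ℝ] ℝ)
    (f : 𝓢(E, ℝ)) (x e : E) :
    fderiv ℝ (linMul l f) x e = l e * f x + l x * fderiv ℝ f x e := by
  have : (linMul l f : E → ℝ) = fun x => l x * f x := funext (linMul_apply l f)
  rw [this, fderiv_fun_mul l.differentiableAt f.differentiableAt]
  simp [mul_comm]; ring

/-- The product of two Schwartz functions, as a Schwartz function. -/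
def schwartzMul {E : Type*} [NormedAddCommGroup E] [NormedSpace ℝ E] (f g : 𝓢(E, ℝ)) : 𝓢(E, ℝ) :=
  smulLeftCLM ℝ f g

lemma schwartzMul_apply {E : Type*} [NormedAddCommGroup E] [NormedSpace ℝ E] (f g : 𝓢(E, ℝ))
    (x : E) : schwartzMul f g x = f x * g x :=
  smulLeftCLM_apply_apply f.hasTemperateGrowth g x

lemma fderiv_schwartzMul {E : Type*} [NormedAddCommGroup E] [NormedSpace ℝ E]
    (f g : 𝓢(E, ℝ)) (x e : E) :
    fderiv ℝ (schwartzMul f g) x e = fderiv ℝ f x e * g x + f x * fderiv ℝ g x e := by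
  have : (schwartzMul f g : E → ℝ) = fun x => f x * g x := funext (schwartzMul_apply f g)
  rw [this, fderiv_fun_mul f.differentiableAt g.differentiableAt]
  simp [mul_comm]; ring

/-- The restriction of a Schwartz function to the horizontal slice at height `y`. -/
def slice {N : ℕ} (f : 𝓢(RN1 N, ℝ)) (y : ℝ) : 𝓢(RN N, ℝ) :=
  compCLMOfAntilipschitz ℝ (g := fun x : RN N => ((x, y) : RN1 N)) (K := 1)
    (by
      have h := ((ContinuousLinearMap.inl ℝ (RN N) ℝ).hasTemperateGrowth).add
        (Function.HasTemperateGrowth.const ((0, y) : RN1 N))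
      have h2 : (fun x : RN N => ((x, y) : RN1 N)) =
        ⇑(ContinuousLinearMap.inl ℝ (RN N) ℝ) + fun _ => ((0, y) : RN1 N) := by ext x <;> simp
      rw [h2]; exact h)
    (AntilipschitzWith.of_le_mul_dist fun a b => by simp [Prod.dist_eq]) f

lemma slice_apply {N : ℕ} (f : 𝓢(RN1 N, ℝ)) (y : ℝ) (x : RN N) : slice f y x = f (x, y) := rfl

lemma fderiv_slice {N : ℕ} (f : 𝓢(RN1 N, ℝ)) (y : ℝ) (x a : RN N) :
    fderiv ℝ (slice f y) x a = fderiv ℝ f (x, y) (a, 0) := by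
  have h := HasFDerivAt.comp x (f.differentiableAt (x := (x, y))).hasFDerivAt
    (hasFDerivAt_prodMk_left (𝕜 := ℝ) x y)
  have h2 : (slice f y : RN N → ℝ) = f ∘ fun x => (x, y) := rfl
  rw [h2, h.fderiv]
  simp

lemma restrict_upperHalf (N : ℕ) : (volume : Measure (RN1 N)).restrict (upperHalf N) =
    (volume : Measure (RN N)).prod (volume.restrict (Set.Ioi 0)) := by
  have : upperHalf N = Set.univ ×ˢ Set.Ioi 0 := by ext; simp [upperHalf]
  rw [this, Measure.volume_eq_prod, ← Measure.prod_restrict, Measure.restrict_univ]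

instance isAddHaarMeasure_volume_RN1 (N : ℕ) : (volume : Measure (RN1 N)).IsAddHaarMeasure := by
  rw [Measure.volume_eq_prod]; infer_instance

lemma integrable_upperHalf {N : ℕ} (f : 𝓢(RN1 N, ℝ)) : Integrable f
    ((volume : Measure (RN N)).prod (volume.restrict (Set.Ioi 0))) := by
  rw [← restrict_upperHalf]; exact f.integrable.integrableOn

lemma integral_fderiv_horizontal {N : ℕ} (f : 𝓢(RN1 N, ℝ)) (a : RN N) :
    ∫ q in upperHalf N, fderiv ℝ f q (a, 0) = 0 := by
  simp_rw [← lineDerivOp_apply_eq_fderiv]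
  rw [restrict_upperHalf, integral_prod_symm _ (integrable_upperHalf _)]
  simp_rw [lineDerivOp_apply_eq_fderiv, ← fderiv_slice, schwartz_integral_fderiv_eq_zero]
  simp

lemma tendsto_vertical {N : ℕ} (f : 𝓢(RN1 N, ℝ)) (x : RN N) :
    Filter.Tendsto (fun y => f (x, y)) Filter.atTop (nhds 0) := by
  refine (f.toZeroAtInfty.zero_at_infty').comp ?_
  rw [← Metric.cobounded_eq_cocompact, ← tendsto_norm_atTop_iff_cobounded]
  refine Filter.tendsto_atTop_mono (fun y => ?_) Filter.tendsto_id
  exact (le_abs_self y).trans (le_max_right ‖x‖ ‖y‖)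

lemma integral_fderiv_vertical {N : ℕ} (f : 𝓢(RN1 N, ℝ)) :
    ∫ q in upperHalf N, fderiv ℝ f q (dirY N) = -∫ x, f (x, 0) := by
  simp_rw [← lineDerivOp_apply_eq_fderiv]
  have hi := integrable_upperHalf (∂_{dirY N} f)
  rw [restrict_upperHalf, integral_prod _ hi, ← integral_neg]
  refine integral_congr_ae ?_
  filter_upwards [hi.prod_right_ae] with x hx
  have hd : ∀ y ∈ Set.Ici (0 : ℝ), HasDerivAt (fun y => f (x, y)) ((∂_{dirY N} f) (x, y)) y := by
    intro y _
    rw [lineDerivOp_apply_eq_fderiv]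
    have h := HasFDerivAt.comp y (f.differentiableAt (x := (x, y))).hasFDerivAt
      (hasFDerivAt_prodMk_right (𝕜 := ℝ) x y)
    have h2 := h.hasDerivAt
    simp only [ContinuousLinearMap.comp_apply, ContinuousLinearMap.inr_apply] at h2
    exact h2
  rw [integral_Ioi_of_hasDerivAt_of_tendsto' hd hx (tendsto_vertical f x), zero_sub]

lemma sum_proj_smul_fderiv {N : ℕ} (s : 𝓢(RN N, ℝ)) (x : RN N) :
    fderiv ℝ s x x = ∑ i, x i * fderiv ℝ s x (EuclideanSpace.single i 1) := by
  conv_lhs => enter [2]; rw [← (EuclideanSpace.basisFun (Fin N) ℝ).sum_repr x]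
  simp

lemma integral_fderiv_self {N : ℕ} (s : 𝓢(RN N, ℝ)) :
    ∫ x, fderiv ℝ s x x = -N * ∫ x, s x := by
  have h : ∀ x, fderiv ℝ s x x = ∑ i, (∂_{EuclideanSpace.single i (1 : ℝ)}
      (linMul (EuclideanSpace.proj i) s) - s) x := by
    intro x
    rw [sum_proj_smul_fderiv]
    simp [lineDerivOp_apply_eq_fderiv, fderiv_linMul]
  simp_rw [h]
  rw [integral_finsetSum _ fun i _ => SchwartzMap.integrable _]
  have h2 : ∀ i : Fin N, ∫ x, (∂_{EuclideanSpace.single i (1 : ℝ)}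
      (linMul (EuclideanSpace.proj i) s) - s) x = - ∫ x, s x := by
    intro i
    simp only [sub_apply]
    rw [integral_sub (SchwartzMap.integrable _) s.integrable]
    simp_rw [lineDerivOp_apply_eq_fderiv, schwartz_integral_fderiv_eq_zero, zero_sub]
  rw [Finset.sum_congr rfl fun i _ => h2 i]
  simp

/-- The Euler vector field `q` applied to a Schwartz function. -/
def euler {N : ℕ} (f : 𝓢(RN1 N, ℝ)) : 𝓢(RN1 N, ℝ) :=
  ∑ i, linMul ((EuclideanSpace.proj i).comp (ContinuousLinearMap.fst ℝ (RN N) ℝ)) (∂_{dirX N i} f) +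
    linMul (ContinuousLinearMap.snd ℝ (RN N) ℝ) (∂_{dirY N} f)

lemma euler_apply {N : ℕ} (f : 𝓢(RN1 N, ℝ)) (q : RN1 N) : euler f q = fderiv ℝ f q q := by
  have hq : q = ∑ i, q.1 i • dirX N i + q.2 • dirY N := by
    have := (EuclideanSpace.basisFun (Fin N) ℝ).sum_repr q.1
    ext1
    · simpa [dirX, dirY, Prod.fst_sum] using this.symm
    · simp [dirX, dirY, Prod.snd_sum]
  conv_rhs => enter [2]; rw [hq]
  rw [map_add, map_sum]
  simp [euler, linMul_apply, lineDerivOp_apply_eq_fderiv]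

lemma integral_euler {N : ℕ} (f : 𝓢(RN1 N, ℝ)) :
    ∫ q in upperHalf N, euler f q = -(N + 1) * ∫ q in upperHalf N, f q := by
  have h : ∀ q, euler f q = (∑ i, (∂_{dirX N i}
      (linMul ((EuclideanSpace.proj i).comp (ContinuousLinearMap.fst ℝ (RN N) ℝ)) f) - f) q) +
      (∂_{dirY N} (linMul (ContinuousLinearMap.snd ℝ (RN N) ℝ) f) - f) q := by
    intro q
    simp [euler, linMul_apply, lineDerivOp_apply_eq_fderiv, fderiv_linMul, dirX, dirY]
  have hI : ∀ g : 𝓢(RN1 N, ℝ), Integrable g (volume.restrict (upperHalf N)) :=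
    fun g => g.integrable.integrableOn
  simp_rw [h]
  rw [integral_add (integrable_finsetSum _ fun i _ => hI _) (hI _),
    integral_finsetSum _ fun i _ => hI _]
  simp only [sub_apply]
  rw [integral_sub (hI _) (hI _)]
  simp_rw [integral_sub (hI _) (hI _), lineDerivOp_apply_eq_fderiv, integral_fderiv_vertical,
    dirX, integral_fderiv_horizontal, linMul_apply]
  simp; ring

lemma euler_schwartzMul {N : ℕ} (f g : 𝓢(RN1 N, ℝ)) (q : RN1 N) :
    euler (schwartzMul f g) q = euler f q * g q + f q * euler g q := by
  simp only [euler_apply, fderiv_schwartzMul]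

lemma fderiv_euler {N : ℕ} (f : 𝓢(RN1 N, ℝ)) (q e : RN1 N) :
    fderiv ℝ (euler f) q e = fderiv ℝ f q e + euler (∂_{e} f) q := by
  have hf : ContDiff ℝ 2 f := f.smooth 2
  have hd : DifferentiableAt ℝ (fderiv ℝ f) q :=
    (hf.fderiv_right (m := 1) le_rfl).differentiable one_ne_zero q
  have h1 : (euler f : RN1 N → ℝ) = fun z => fderiv ℝ f z z := funext (euler_apply f)
  have h2 : ((∂_{e} f : 𝓢(RN1 N, ℝ)) : RN1 N → ℝ) = fun z => fderiv ℝ f z e :=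
    funext (lineDerivOp_apply_eq_fderiv e f)
  have hs : IsSymmSndFDerivAt ℝ f q := hf.contDiffAt.isSymmSndFDerivAt (by simp)
  have h3 : HasFDerivAt (fun z => fderiv ℝ f z z) _ q :=
    hd.hasFDerivAt.clm_apply (hasFDerivAt_id q)
  rw [euler_apply, h1, h2, h3.fderiv,
    (hd.hasFDerivAt.clm_apply (hasFDerivAt_const e q)).fderiv]
  simpa using hs e q

lemma hasTemperateGrowth_norm_fst_sq (N : ℕ) :
    Function.HasTemperateGrowth (fun q : RN1 N => ‖q.1‖ ^ 2) :=
  (Function.hasTemperateGrowth_norm_sq (RN N)).comp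
    (ContinuousLinearMap.fst ℝ (RN N) ℝ).hasTemperateGrowth

/-- Multiplication of a Schwartz function by the potential `|x|²`. -/
def potMul {N : ℕ} (f : 𝓢(RN1 N, ℝ)) : 𝓢(RN1 N, ℝ) :=
  smulLeftCLM ℝ (fun q : RN1 N => ‖q.1‖ ^ 2) f

lemma potMul_apply {N : ℕ} (f : 𝓢(RN1 N, ℝ)) (q : RN1 N) : potMul f q = ‖q.1‖ ^ 2 * f q :=
  smulLeftCLM_apply_apply (hasTemperateGrowth_norm_fst_sq N) f q

lemma euler_potMul {N : ℕ} (f : 𝓢(RN1 N, ℝ)) (q : RN1 N) :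
    euler (potMul f) q = 2 * potMul f q + potMul (euler f) q := by
  have h1 : (potMul f : RN1 N → ℝ) = fun z => ‖z.1‖ ^ 2 * f z := funext (potMul_apply f)
  have h2 : HasFDerivAt (fun z : RN1 N => ‖z.1‖ ^ 2) _ q := (hasFDerivAt_fst (𝕜 := ℝ)).norm_sq
  rw [euler_apply, h1, (h2.fun_mul f.differentiableAt.hasFDerivAt).fderiv, potMul_apply, euler_apply]
  simp
  ring

lemma integrableOn_upperHalf {N : ℕ} (f : 𝓢(RN1 N, ℝ)) : IntegrableOn f (upperHalf N) :=
  f.integrable.integrableOn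

lemma integral_mul_lineDerivOp_lineDerivOp {N : ℕ} (u v : 𝓢(RN1 N, ℝ)) (e : RN1 N) :
    ∫ q in upperHalf N, schwartzMul u (∂_{e} (∂_{e} v)) q =
      (∫ q in upperHalf N, fderiv ℝ (schwartzMul u (∂_{e} v)) q e) -
        ∫ q in upperHalf N, schwartzMul (∂_{e} u) (∂_{e} v) q := by
  simp_rw [← lineDerivOp_apply_eq_fderiv]
  rw [← integral_sub (integrableOn_upperHalf _) (integrableOn_upperHalf _)]
  congr 1 with q
  simp only [lineDerivOp_apply_eq_fderiv, fderiv_schwartzMul, schwartzMul_apply]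
  ring

/-- Half-space integral of the scalar product of two gradients. -/
def dirichletForm {N : ℕ} (u v : 𝓢(RN1 N, ℝ)) : ℝ :=
  (∑ i, ∫ q in upperHalf N, schwartzMul (∂_{dirX N i} u) (∂_{dirX N i} v) q) +
    ∫ q in upperHalf N, schwartzMul (∂_{dirY N} u) (∂_{dirY N} v) q

lemma lap_eq {N : ℕ} (v : 𝓢(RN1 N, ℝ)) (q : RN1 N) :
    lap N v q = (∑ i, (∂_{dirX N i} (∂_{dirX N i} v)) q) + (∂_{dirY N} (∂_{dirY N} v)) q := by
  have h : ∀ e, ((∂_{e} v : 𝓢(RN1 N, ℝ)) : RN1 N → ℝ) = fun z => fderiv ℝ v z e :=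
    fun e => funext (lineDerivOp_apply_eq_fderiv e v)
  simp only [lap, lineDerivOp_apply_eq_fderiv, h]

lemma green_identity {N : ℕ} (u v : 𝓢(RN1 N, ℝ))
    (hpde : ∀ q : RN1 N, 0 < q.2 → -lap N v q + ‖q.1‖ ^ 2 * v q = 0) :
    ∫ q in upperHalf N, potMul (schwartzMul u v) q =
      -dirichletForm u v - ∫ x, u (x, 0) * (∂_{dirY N} v) (x, 0) := by
  have h : ∫ q in upperHalf N, potMul (schwartzMul u v) q = ∫ q in upperHalf N,
      ((∑ i, schwartzMul u (∂_{dirX N i} (∂_{dirX N i} v)) q) +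
        schwartzMul u (∂_{dirY N} (∂_{dirY N} v)) q) := by
    refine setIntegral_congr_fun (measurableSet_lt measurable_const measurable_snd) fun q hq => ?_
    have h1 := hpde q hq
    rw [lap_eq] at h1
    simp only [potMul_apply, schwartzMul_apply, ← Finset.mul_sum]
    linear_combination u q * h1
  rw [h, integral_add (integrable_finsetSum _ fun i _ => integrableOn_upperHalf _)
    (integrableOn_upperHalf _), integral_finsetSum _ fun i _ => integrableOn_upperHalf _]
  simp_rw [integral_mul_lineDerivOp_lineDerivOp, integral_fderiv_vertical, dirX,
    integral_fderiv_horizontal, dirichletForm, schwartzMul_apply]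
  simp [dirX]
  ring

lemma dirichletForm_euler {N : ℕ} (v : 𝓢(RN1 N, ℝ)) :
    dirichletForm (euler v) v = (1 - N) / 2 * dirichletForm v v := by
  have h : ∀ e : RN1 N, ∫ q in upperHalf N, schwartzMul (∂_{e} (euler v)) (∂_{e} v) q =
      (1 - N) / 2 * ∫ q in upperHalf N, schwartzMul (∂_{e} v) (∂_{e} v) q := by
    intro e
    have h1 := integral_euler (schwartzMul (∂_{e} v) (∂_{e} v))
    have h2 : ∫ q in upperHalf N, schwartzMul (∂_{e} (euler v)) (∂_{e} v) q =
        ∫ q in upperHalf N, (schwartzMul (∂_{e} v) (∂_{e} v) q +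
          2⁻¹ * euler (schwartzMul (∂_{e} v) (∂_{e} v)) q) := by
      congr 1 with q
      rw [euler_schwartzMul, schwartzMul_apply, schwartzMul_apply, lineDerivOp_apply_eq_fderiv,
        fderiv_euler, lineDerivOp_apply_eq_fderiv]
      ring
    rw [h2, integral_add (integrableOn_upperHalf _) ((integrableOn_upperHalf _).const_mul _),
      integral_const_mul, h1]
    ring
  simp only [dirichletForm, h, ← Finset.mul_sum]
  ring

lemma integral_potMul_euler {N : ℕ} (v : 𝓢(RN1 N, ℝ)) :
    ∫ q in upperHalf N, potMul (schwartzMul (euler v) v) q =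
      -((N + 3) / 2) * ∫ q in upperHalf N, potMul (schwartzMul v v) q := by
  have h1 := integral_euler (potMul (schwartzMul v v))
  have h2 : ∫ q in upperHalf N, potMul (schwartzMul (euler v) v) q =
      ∫ q in upperHalf N, (2⁻¹ * euler (potMul (schwartzMul v v)) q -
        potMul (schwartzMul v v) q) := by
    congr 1 with q
    simp only [euler_potMul, potMul_apply, euler_schwartzMul, schwartzMul_apply]
    ring
  rw [h2, integral_sub ((integrableOn_upperHalf _).const_mul _) (integrableOn_upperHalf _),
    integral_const_mul, h1]
  ring

lemma boundary_mul_eq {N : ℕ} {p : ℝ} (hp : 1 < p) (v : 𝓢(RN1 N, ℝ))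
    (hbdry : ∀ x : RN N, -(fderiv ℝ (v : RN1 N → ℝ) (x, 0) (dirY N)) =
      |v (x, 0)| ^ (p - 2) * v (x, 0)) (x : RN N) :
    v (x, 0) * (∂_{dirY N} v) (x, 0) = -|v (x, 0)| ^ p := by
  have h := hbdry x
  rw [lineDerivOp_apply_eq_fderiv]
  have h2 : |v (x, 0)| ^ p = |v (x, 0)| ^ (p - 2) * v (x, 0) * v (x, 0) := by
    rcases eq_or_ne (v (x, 0)) 0 with h0 | h0
    · simp [h0, Real.zero_rpow (by linarith : p ≠ 0)]
    · rw [mul_assoc, ← abs_mul_abs_self, ← sq, ← Real.rpow_natCast, ← Real.rpow_add (by positivity)]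
      norm_num
  rw [h2]
  linear_combination -(v (x, 0)) * h

lemma integral_boundary_euler {N : ℕ} {p : ℝ} (hp : 1 < p) (v : 𝓢(RN1 N, ℝ))
    (hbdry : ∀ x : RN N, -(fderiv ℝ (v : RN1 N → ℝ) (x, 0) (dirY N)) =
      |v (x, 0)| ^ (p - 2) * v (x, 0)) :
    p * ∫ x, euler v (x, 0) * (∂_{dirY N} v) (x, 0) =
      -N * ∫ x, v (x, 0) * (∂_{dirY N} v) (x, 0) := by
  have h1 := integral_fderiv_self (slice (schwartzMul v (∂_{dirY N} v)) 0)
  have h2 : (slice (schwartzMul v (∂_{dirY N} v)) 0 : RN N → ℝ) = fun x => -|slice v 0 x| ^ p := by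
    ext x
    rw [slice_apply, schwartzMul_apply, boundary_mul_eq hp v hbdry, slice_apply]
  have h3 : ∀ x, fderiv ℝ (slice (schwartzMul v (∂_{dirY N} v)) 0) x x =
      p * (euler v (x, 0) * (∂_{dirY N} v) (x, 0)) := by
    intro x
    have h4 := ((hasDerivAt_abs_rpow (slice v 0 x) hp).comp_hasFDerivAt x
      ((slice v 0).differentiableAt (x := x)).hasFDerivAt).neg
    have h5 : (fun x => -|slice v 0 x| ^ p) = -((fun x => |x| ^ p) ∘ slice v 0) := rfl
    rw [h2, h5, h4.fderiv]
    simp only [neg_apply, smul_apply, fderiv_slice,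
      smul_eq_mul, slice_apply, euler_apply, lineDerivOp_apply_eq_fderiv]
    linear_combination p * fderiv ℝ v (x, 0) (x, 0) * hbdry x
  simp_rw [h3, slice_apply, schwartzMul_apply] at h1
  rwa [integral_const_mul] at h1

theorem stmt11 (N : ℕ) (hN : 2 ≤ N) (p : ℝ) (hp : twoStar N ≤ p) (v : SchwartzMap (RN1 N) ℝ)
    (hpde : ∀ q : RN1 N, 0 < q.2 → -lap N v q + ‖q.1‖ ^ 2 * v q = 0)
    (hbdry : ∀ x : RN N, -(fderiv ℝ (v : RN1 N → ℝ) (x, 0) (dirY N)) =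
      |v (x, 0)| ^ (p - 2) * v (x, 0)) :
    ∀ x : RN N, ∀ y : ℝ, 0 ≤ y → v (x, y) = 0 := by
  have hN' : (2 : ℝ) ≤ N := by exact_mod_cast hN
  have hpN : 2 * (N : ℝ) ≤ p * (N - 1) := by
    rwa [twoStar, div_le_iff₀ (by linarith)] at hp
  have hp1 : 1 < p := by nlinarith
  have energy := green_identity v v hpde
  have pohozaev := green_identity (euler v) v hpde
  have bdry := integral_boundary_euler hp1 v hbdry
  rw [integral_potMul_euler, dirichletForm_euler] at pohozaev
  have hB : ∫ x, v (x, 0) * (∂_{dirY N} v) (x, 0) ≤ 0 := by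
    refine integral_nonpos fun x => ?_
    simp only [boundary_mul_eq hp1 v hbdry, Pi.zero_apply]
    exact neg_nonpos.2 (by positivity)
  have hW : 0 ≤ᵐ[volume.restrict (upperHalf N)] potMul (schwartzMul v v) := by
    refine Filter.Eventually.of_forall fun q => ?_
    simp only [Pi.zero_apply, potMul_apply, schwartzMul_apply]
    exact mul_nonneg (by positivity) (mul_self_nonneg _)
  have hJ : ∫ q in upperHalf N, potMul (schwartzMul v v) q = 0 := by
    refine le_antisymm ?_ (integral_nonneg_of_ae hW)
    set JW := ∫ q in upperHalf N, potMul (schwartzMul v v) q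
    set b := ∫ x, v (x, 0) * (∂_{dirY N} v) (x, 0)
    set c := ∫ x, euler v (x, 0) * (∂_{dirY N} v) (x, 0)
    have h1 : 2 * JW = (N - 1) / 2 * b + c := by linear_combination (1 - N) / 2 * energy - pohozaev
    have h2 : p * (4 * JW) = (p * (N - 1) - 2 * N) * b := by
      linear_combination 2 * p * h1 + 2 * bdry
    by_contra! h
    nlinarith [mul_pos (by linarith : 0 < p) h]
  have hopen : IsOpen (upperHalf N) := isOpen_lt continuous_const continuous_snd
  have hzero : Set.EqOn (potMul (schwartzMul v v)) 0 (upperHalf N) :=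
    Measure.eqOn_open_of_ae_eq
      ((integral_eq_zero_iff_of_nonneg_ae hW (integrableOn_upperHalf _)).1 hJ) hopen
      (SchwartzMap.continuous _).continuousOn continuousOn_const
  have hv : Set.EqOn v 0 ({0}ᶜ ×ˢ Set.Ioi 0) := by
    rintro q ⟨hq1, hq2⟩
    have h := hzero (x := q) hq2
    simpa [potMul_apply, schwartzMul_apply, show q.1 ≠ 0 from hq1] using h
  intro x y hy
  have : Nonempty (Fin N) := ⟨⟨0, by lia⟩⟩
  refine hv.closure v.continuous continuous_const (x := (x, y)) ?_
  rw [closure_prod_eq, closure_Ioi, (dense_compl_singleton (0 : RN N)).closure_eq]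
  exact ⟨trivial, hy⟩
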